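/- There is a group isomorphism between the presented group on two generators x, y with relators x^2 y x^{-1} y x^{-1} y^{-1} and y^{-2} x^{-1} y x^{-1} y x, and the presented group G(P_2) on two generators x, y with relators (xyx)(yxy)^{-1} and x^3 y^{-2}. -/

import Mathlib

/-- The relators x^2 y x^{-1} y x^{-1} y^{-1} and y^{-2} x^{-1} y x^{-1} y x
of the fundamental group presentation of the twin handlebody W_0^*,
with `x = FreeGroup.of 0`, `y = FreeGroup.of 1`. -/
def twinRels : Set (FreeGroup (Fin 2)) :=
  { (FreeGroup.of 0) ^ 2 * FreeGroup.of 1 * (FreeGroup.of 0)⁻¹ *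
      FreeGroup.of 1 * (FreeGroup.of 0)⁻¹ * (FreeGroup.of 1)⁻¹,
    ((FreeGroup.of 1)⁻¹) ^ 2 * (FreeGroup.of 0)⁻¹ * FreeGroup.of 1 *
      (FreeGroup.of 0)⁻¹ * FreeGroup.of 1 * FreeGroup.of 0 }

/-- The relators (xyx)(yxy)^{-1} and x^3 y^{-2} of the presentation
G(P_2) = ⟨x, y | xyx = yxy, x^3 = y^2⟩, with `x = FreeGroup.of 0`,
`y = FreeGroup.of 1`. -/
def GP2Rels : Set (FreeGroup (Fin 2)) :=
  { (FreeGroup.of 0 * FreeGroup.of 1 * FreeGroup.of 0) *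
      (FreeGroup.of 1 * FreeGroup.of 0 * FreeGroup.of 1)⁻¹,
    (FreeGroup.of 0) ^ 3 * ((FreeGroup.of 1) ^ 2)⁻¹ }

/-- A presented group is trivial as soon as all its generators are. -/
theorem PresentedGroup.subsingleton_of_forall_of_eq_one {α : Type*} {rels : Set (FreeGroup α)}
    (h : ∀ a, (PresentedGroup.of a : PresentedGroup rels) = 1) :
    Subsingleton (PresentedGroup rels) := by
  have hid : MonoidHom.id (PresentedGroup rels) = 1 := by
    ext a
    simpa using h a
  exact subsingleton_of_forall_eq 1 fun g => DFunLike.congr_fun hid g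

theorem eq_one_of_twin_relations {G : Type*} [Group G] {x y : G}
    (h₁ : x ^ 2 * y * x⁻¹ * y * x⁻¹ * y⁻¹ = 1)
    (h₂ : y⁻¹ ^ 2 * x⁻¹ * y * x⁻¹ * y * x = 1) : x = 1 ∧ y = 1 := by
  obtain ⟨w, rfl⟩ : ∃ w, y = x ^ 2 * w * x⁻¹ := ⟨x⁻¹ ^ 2 * y * x, by group⟩
  have hw : x ^ 2 * w ^ 2 = w * x := by
    have h : x ^ 2 * (x ^ 2 * w ^ 2 * (w * x)⁻¹) * (x ^ 2)⁻¹ = 1 := by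
      rw [← h₁]; simp [pow_succ, mul_assoc]
    exact mul_inv_eq_one.mp (conj_eq_one_iff.mp h)
  have hconj₂ : w⁻¹ * x ^ 2 * w = x * w⁻¹ := by
    calc w⁻¹ * x ^ 2 * w = w⁻¹ * (x ^ 2 * w ^ 2) * w⁻¹ := by group
      _ = x * w⁻¹ := by rw [hw]; group
  have hconj₃ : w⁻¹ * x ^ 3 * w = x ^ 2 * w⁻¹ * x⁻¹ := by
    have hy : (x ^ 2 * w * x⁻¹) ^ 2 = x⁻¹ * (x ^ 2 * w ^ 2) := by
      refine inv_mul_eq_one.mp ?_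
      rw [← h₂]; simp [pow_succ, mul_assoc]
    rw [hw] at hy
    calc w⁻¹ * x ^ 3 * w = w⁻¹ * x * (x ^ 2 * w * x⁻¹) ^ 2 * x * w⁻¹ * x⁻¹ := by
          simp [pow_succ, mul_assoc]
      _ = x ^ 2 * w⁻¹ * x⁻¹ := by rw [hy]; simp [pow_succ, mul_assoc]
  have hcomm : (x ^ 2 * w⁻¹ * x⁻¹) * (x * w⁻¹) = (x * w⁻¹) * (x ^ 2 * w⁻¹ * x⁻¹) := by
    rw [← hconj₂, ← hconj₃]; group
  have hwx : w = x⁻¹ := by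
    have h : x * w⁻¹ * w⁻¹ = x * w⁻¹ * w⁻¹ * (w⁻¹ * x⁻¹) := by
      calc x * w⁻¹ * w⁻¹ = x⁻¹ * ((x ^ 2 * w⁻¹ * x⁻¹) * (x * w⁻¹)) := by group
        _ = (w⁻¹ * x ^ 2 * w) * w⁻¹ * w⁻¹ * x⁻¹ := by rw [hcomm]; group
        _ = x * w⁻¹ * w⁻¹ * (w⁻¹ * x⁻¹) := by rw [hconj₂]; group
    exact inv_mul_eq_one.mp (left_eq_mul.mp h)
  subst hwx
  have hx : x = 1 := by
    have h : x * x ^ 2 = 1 * x ^ 2 := by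
      calc x * x ^ 2 = x⁻¹⁻¹ * x ^ 3 * x⁻¹ := by group
        _ = 1 * x ^ 2 := by rw [hconj₃]; group
    exact mul_right_cancel h
  simp [hx]

theorem eq_one_of_braid_of_cube_eq_sq {G : Type*} [Group G] {x y : G}
    (hb : x * y * x = y * x * y) (h : x ^ 3 = y ^ 2) : x = 1 ∧ y = 1 := by
  have hconj : SemiconjBy (x * y) x y := by
    rw [SemiconjBy, hb, mul_assoc]
  have hcent : SemiconjBy (x * y) (y ^ 2) (y ^ 2) := by
    have hx : Commute x (y ^ 2) := h ▸ Commute.self_pow x 3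
    exact hx.mul_left (Commute.self_pow y 2)
  have hsq : x ^ 2 = y ^ 2 :=
    mul_left_cancel ((hconj.pow_right 2).eq.trans hcent.eq.symm)
  have hx : x = 1 := by
    rw [← hsq, pow_succ] at h
    exact mul_eq_left.mp h
  subst hx
  simpa using hb

theorem subsingleton_presentedGroup_twinRels : Subsingleton (PresentedGroup twinRels) := by
  have h := eq_one_of_twin_relations
    (x := (PresentedGroup.of 0 : PresentedGroup twinRels)) (y := PresentedGroup.of 1)
    (PresentedGroup.one_of_mem (rels := twinRels) (Set.mem_insert _ _))
    (PresentedGroup.one_of_mem (rels := twinRels) (Set.mem_insert_of_mem _ rfl))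
  exact PresentedGroup.subsingleton_of_forall_of_eq_one (Fin.forall_fin_two.mpr h)

theorem subsingleton_presentedGroup_GP2Rels : Subsingleton (PresentedGroup GP2Rels) := by
  have h := eq_one_of_braid_of_cube_eq_sq
    (x := (PresentedGroup.of 0 : PresentedGroup GP2Rels)) (y := PresentedGroup.of 1)
    (mul_inv_eq_one.mp (PresentedGroup.one_of_mem (rels := GP2Rels) (Set.mem_insert _ _)))
    (mul_inv_eq_one.mp
      (PresentedGroup.one_of_mem (rels := GP2Rels) (Set.mem_insert_of_mem _ rfl)))
  exact PresentedGroup.subsingleton_of_forall_of_eq_one (Fin.forall_fin_two.mpr h)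

theorem twin_iso_GP2 :
    Nonempty (PresentedGroup twinRels ≃* PresentedGroup GP2Rels) := by
  have := subsingleton_presentedGroup_twinRels
  have := subsingleton_presentedGroup_GP2Rels
  have := uniqueOfSubsingleton (1 : PresentedGroup twinRels)
  have := uniqueOfSubsingleton (1 : PresentedGroup GP2Rels)
  exact ⟨MulEquiv.ofUnique⟩
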